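/- For every constant C ∈ ℕ there exists c > 0 such that the following holds. Let m ≥ 1, let S₀,…,S_m be disjoint subsets of ℤ² with #S_j ≤ 2^j, let λ₀,…,λ_m ≥ 0, and let f = Σ_{j=0}^m λ_j 2^{−j/2} χ_{S_j}. Assume that for each j and each ξ ∈ S_j there exists at most one line ℓ through ξ with #(ℓ ∩ S_j) ≥ 2^{j/2+C}. Then Σ_{Q ∈ 𝒬⁰_{3,3}} f(Q) ≤ c (Σ_{j=0}^m λ_j²)². -/

import Mathlib

open scoped BigOperators

noncomputable section

/-- Points of the integer lattice `ℤ²`. -/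
abbrev Pt := ℤ × ℤ

/-- A quadruple of lattice points, viewed as a function on `Fin 4`
(indices taken cyclically). -/
abbrev Quad := Fin 4 → Pt

/-- The embedding `ℤ² ↪ ℝ²`. -/
def emb (ξ : Pt) : ℝ × ℝ := ((ξ.1 : ℝ), (ξ.2 : ℝ))

/-- An affine line in the plane `ℝ²`. -/
def IsLine (ℓ : Set (ℝ × ℝ)) : Prop :=
  ∃ p v : ℝ × ℝ, v ≠ 0 ∧ ℓ = {x | ∃ t : ℝ, x = p + t • v}

/-- The line through two lattice points `p ≠ q` (a degenerate point if `p = q`). -/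
def lineThrough (p q : Pt) : Set (ℝ × ℝ) :=
  {x | ∃ t : ℝ, x = emb p + t • (emb q - emb p)}

/-- The number of points of a finite set `T ⊂ ℤ²` on a set `ℓ ⊂ ℝ²`,
i.e. `#(ℓ ∩ T)`. -/
def lineCount (ℓ : Set (ℝ × ℝ)) (T : Finset Pt) : ℕ :=
  (ℓ ∩ (emb '' (T : Set Pt))).ncard

/-- `Q = (ξ₁,ξ₂,ξ₃,ξ₄)` is a parallelogram: `ξ₁ + ξ₃ = ξ₂ + ξ₄`. -/
def IsPara (Q : Quad) : Prop := Q 0 + Q 2 = Q 1 + Q 3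

/-- The dot product `(ξ₁ − ξ₂)·(ξ₁ − ξ₄)`. -/
def dotQ (Q : Quad) : ℤ :=
  ((Q 0).1 - (Q 1).1) * ((Q 0).1 - (Q 3).1) + ((Q 0).2 - (Q 1).2) * ((Q 0).2 - (Q 3).2)

/-- `τ_Q = ||ξ₁|² − |ξ₂|² + |ξ₃|² − |ξ₄|²| = 2|(ξ₁−ξ₂)·(ξ₁−ξ₄)|`. -/
def tauQ (Q : Quad) : ℤ := 2 * |dotQ Q|

/-- `Q` is a rectangle: a parallelogram with `τ_Q = 0`. Membership in `𝒬⁰`. -/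
def IsRect (Q : Quad) : Prop := IsPara Q ∧ dotQ Q = 0

/-- `f(Q) = f(ξ₁)f(ξ₂)f(ξ₃)f(ξ₄)`. -/
def fQ (f : Pt → ℝ) (Q : Quad) : ℝ := ∏ k : Fin 4, f (Q k)

/-- The weight `f = ∑_{j=0}^m λ_j 2^{−j/2} χ_{S_j}`. -/
def fWt (S : ℕ → Finset Pt) (lam : ℕ → ℝ) (m : ℕ) (ξ : Pt) : ℝ :=
  ∑ j ∈ Finset.range (m + 1), if ξ ∈ S j then lam j * (2 : ℝ) ^ (-(j : ℝ) / 2) else 0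

/-- `gcd((a,b)) = gcd(|a|,|b|)` for `(a,b) ∈ ℤ²`. -/
def gcdP (ξ : Pt) : ℕ := Int.gcd ξ.1 ξ.2

/-- `max{#(ℓ(ξ,η₁) ∩ S_j), #(ℓ(ξ,η₂) ∩ S_j)}`, where `η₁, η₂` are the two
neighboring vertices of `ξ` in a rectangle. -/
def crossMax (S : ℕ → Finset Pt) (j : ℕ) (ξ η₁ η₂ : Pt) : ℕ :=
  max (lineCount (lineThrough ξ η₁) (S j)) (lineCount (lineThrough ξ η₂) (S j))

/-- `ξ` lies in some `S_j`, `j ≤ m`, and is a vertex of type `α ∈ {1,2,3}`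
relative to its neighbors `η₁, η₂`: with `a := log₂ crossMax`, type 1 means
`a ≥ j/2 + C` (i.e. `crossMax ≥ 2^{j/2+C}`), type 2 means `1 ≤ a < j/2 + C`
(i.e. `2 ≤ crossMax < 2^{j/2+C}`), and type 3 means `a = 0` (`crossMax = 1`). -/
def VertexType (S : ℕ → Finset Pt) (C m : ℕ) (α : ℕ) (ξ η₁ η₂ : Pt) : Prop :=
  ∃ j ≤ m, ξ ∈ S j ∧
    ((α = 1 ∧ (2 : ℝ) ^ ((j : ℝ) / 2 + (C : ℝ)) ≤ (crossMax S j ξ η₁ η₂ : ℝ)) ∨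
     (α = 2 ∧ 2 ≤ crossMax S j ξ η₁ η₂ ∧
        (crossMax S j ξ η₁ η₂ : ℝ) < (2 : ℝ) ^ ((j : ℝ) / 2 + (C : ℝ))) ∨
     (α = 3 ∧ crossMax S j ξ η₁ η₂ = 1))

/-- The set `𝒬⁰_{α,β}`: rectangles with four distinct vertices, all in
`∪_{j=0}^m S_j`, with `ξ₁, ξ₂` of type `α` and `ξ₃, ξ₄` of type `β`. -/
def QZeroAB (S : ℕ → Finset Pt) (C m : ℕ) (α β : ℕ) : Set Quad :=
  {Q | IsRect Q ∧ Function.Injective Q ∧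
    VertexType S C m α (Q 0) (Q 1) (Q 3) ∧
    VertexType S C m α (Q 1) (Q 2) (Q 0) ∧
    VertexType S C m β (Q 2) (Q 3) (Q 1) ∧
    VertexType S C m β (Q 3) (Q 0) (Q 2)}

/-- The set `𝒬⁰(j⃗, a⃗)`: rectangles with distinct vertices `ξ_k ∈ S_{j_k}` such
that for each `k` (cyclically), `2^{a_k} ≤ max{#(ℓ(ξ_k,ξ_{k+1}) ∩ S_{j_k}),
#(ℓ(ξ_k,ξ_{k−1}) ∩ S_{j_k})} < 2^{a_k+1}`. -/
def QZeroJA (S : ℕ → Finset Pt) (j a : Fin 4 → ℕ) : Set Quad :=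
  {Q | IsRect Q ∧ Function.Injective Q ∧ (∀ k, Q k ∈ S (j k)) ∧
    ∀ k : Fin 4,
      2 ^ (a k) ≤ max (lineCount (lineThrough (Q k) (Q (k + 1))) (S (j k)))
          (lineCount (lineThrough (Q k) (Q (k - 1))) (S (j k))) ∧
        max (lineCount (lineThrough (Q k) (Q (k + 1))) (S (j k)))
          (lineCount (lineThrough (Q k) (Q (k - 1))) (S (j k))) < 2 ^ (a k + 1)}


/-- A non-degenerate rectangle with vertices `Q k ∈ T k` such that the line through each side
`Q k, Q (k + 1)` contains at most one point of `T k`. -/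
structure IsSparseRect (T : Fin 4 → Finset Pt) (Q : Quad) : Prop where
  mem : ∀ k, Q k ∈ T k
  ne : ∀ k, Q k ≠ Q (k + 1)
  para : ∀ k, Q k + Q (k + 2) = Q (k + 1) + Q (k + 3)
  dot : ∀ k, ((Q k).1 - (Q (k + 1)).1) * ((Q k).1 - (Q (k + 3)).1) +
    ((Q k).2 - (Q (k + 1)).2) * ((Q k).2 - (Q (k + 3)).2) = 0
  count : ∀ k, lineCount (lineThrough (Q k) (Q (k + 1))) (T k) ≤ 1

lemma emb_injective : Function.Injective emb := by
  intro p q h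
  simp only [emb, Prod.mk.injEq, Int.cast_inj] at h
  exact Prod.ext h.1 h.2

lemma eq_of_lineCount_le_one {ℓ : Set (ℝ × ℝ)} {T : Finset Pt} (h : lineCount ℓ T ≤ 1)
    {x y : Pt} (hx : x ∈ T) (hy : y ∈ T) (hxl : emb x ∈ ℓ) (hyl : emb y ∈ ℓ) : x = y := by
  have hfin : (ℓ ∩ (emb '' (T : Set Pt))).Finite :=
    (T.finite_toSet.image emb).subset Set.inter_subset_right
  exact emb_injective ((Set.ncard_le_one hfin).1 h _ ⟨hxl, x, hx, rfl⟩ _ ⟨hyl, y, hy, rfl⟩)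

lemma emb_left_mem_lineThrough (p q : Pt) : emb p ∈ lineThrough p q := ⟨0, by simp⟩

/-- If `p a` and `p b` are both perpendicular to `p q`, then `b` lies on the line `a p`. -/
lemma emb_mem_lineThrough_of_perp {p q a b : Pt} (hpq : p ≠ q) (hap : a ≠ p)
    (ha : (p.1 - q.1) * (p.1 - a.1) + (p.2 - q.2) * (p.2 - a.2) = 0)
    (hb : (p.1 - q.1) * (p.1 - b.1) + (p.2 - q.2) * (p.2 - b.2) = 0) :
    emb b ∈ lineThrough a p := by
  obtain ⟨p1, p2⟩ := p
  obtain ⟨q1, q2⟩ := q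
  obtain ⟨a1, a2⟩ := a
  obtain ⟨b1, b2⟩ := b
  simp only [ne_eq, Prod.mk.injEq, not_and_or] at hpq hap ha hb
  have hcross : (p1 - a1) * (p2 - b2) = (p2 - a2) * (p1 - b1) := by
    rcases hpq with h | h
    · refine mul_left_cancel₀ (sub_ne_zero.2 h) ?_
      linear_combination (p2 - b2) * ha - (p2 - a2) * hb
    · refine mul_left_cancel₀ (sub_ne_zero.2 h) ?_
      linear_combination (p1 - a1) * hb - (p1 - b1) * ha
  have hcross' : ((p1 : ℝ) - a1) * (p2 - b2) = (p2 - a2) * (p1 - b1) := by exact_mod_cast hcross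
  rcases hap with h | h
  · have h' : (p1 : ℝ) - a1 ≠ 0 := sub_ne_zero.2 (by exact_mod_cast Ne.symm h)
    refine ⟨((b1 : ℝ) - a1) / (p1 - a1), ?_⟩
    simp only [emb, Prod.mk_sub_mk, Prod.smul_mk, Prod.mk_add_mk, smul_eq_mul, Prod.mk.injEq]
    constructor
    · field_simp; ring
    · field_simp; linear_combination -hcross'
  · have h' : (p2 : ℝ) - a2 ≠ 0 := sub_ne_zero.2 (by exact_mod_cast Ne.symm h)
    refine ⟨((b2 : ℝ) - a2) / (p2 - a2), ?_⟩
    simp only [emb, Prod.mk_sub_mk, Prod.smul_mk, Prod.mk_add_mk, smul_eq_mul, Prod.mk.injEq]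
    constructor
    · field_simp; linear_combination hcross'
    · field_simp; ring

/-- A sparse rectangle is determined by any of its sides. -/
lemma IsSparseRect.eq_of_side {T : Fin 4 → Finset Pt} {Q Q' : Quad} (h : IsSparseRect T Q)
    (h' : IsSparseRect T Q') {k : Fin 4} (h0 : Q k = Q' k) (h1 : Q (k + 1) = Q' (k + 1)) :
    Q = Q' := by
  have hk : k + 3 + 1 = k := by rw [add_assoc]; exact add_zero k
  have h3 : Q (k + 3) = Q' (k + 3) := by
    have hc := h.count (k + 3)
    have hn := h.ne (k + 3)
    have hd' := h'.dot k
    rw [hk] at hc hn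
    rw [← h0, ← h1] at hd'
    exact eq_of_lineCount_le_one hc (h.mem _) (h'.mem _) (emb_left_mem_lineThrough _ _)
      (emb_mem_lineThrough_of_perp (h.ne k) hn (h.dot k) hd')
  have h2 : Q (k + 2) = Q' (k + 2) := by
    have hp := h.para k
    rw [h0, h1, h3, ← h'.para k] at hp
    exact add_left_cancel hp
  funext i
  obtain ⟨d, rfl⟩ : ∃ d, i = k + d := ⟨i - k, by abel⟩
  fin_cases d
  · simpa using h0
  · exact h1
  · exact h2
  · exact h3

lemma card_le_of_isSparseRect {T : Fin 4 → Finset Pt} {F : Finset Quad}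
    (hF : ∀ Q ∈ F, IsSparseRect T Q) (k : Fin 4) :
    F.card ≤ (T k).card * (T (k + 1)).card := by
  rw [← Finset.card_product]
  refine Finset.card_le_card_of_injOn (fun Q => (Q k, Q (k + 1)))
    (fun Q hQ => Finset.mem_product.2 ⟨(hF Q hQ).mem _, (hF Q hQ).mem _⟩) ?_
  intro Q hQ Q' hQ' h
  simp only [Prod.mk.injEq] at h
  exact (hF Q hQ).eq_of_side (hF Q' hQ') h.1 h.2

lemma card_le_two_pow_of_isSparseRect {S : ℕ → Finset Pt} {j : Fin 4 → ℕ}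
    (hS : ∀ k, (S (j k)).card ≤ 2 ^ j k) {F : Finset Quad}
    (hF : ∀ Q ∈ F, IsSparseRect (fun k => S (j k)) Q) :
    F.card ≤ 2 ^ min (j 0) (j 2) * 2 ^ min (j 1) (j 3) := by
  have key (k : Fin 4) : F.card ≤ 2 ^ j k * 2 ^ j (k + 1) :=
    (card_le_of_isSparseRect hF k).trans (Nat.mul_le_mul (hS _) (hS _))
  have k0 : F.card ≤ 2 ^ j 0 * 2 ^ j 1 := key 0
  have k1 : F.card ≤ 2 ^ j 1 * 2 ^ j 2 := key 1
  have k2 : F.card ≤ 2 ^ j 2 * 2 ^ j 3 := key 2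
  have k3 : F.card ≤ 2 ^ j 3 * 2 ^ j 0 := key 3
  rcases le_total (j 0) (j 2) with ha | ha <;> rcases le_total (j 1) (j 3) with hb | hb <;>
    simp only [ha, hb, min_eq_left, min_eq_right] <;> linarith

lemma sum_range_pow_dist_le {r : ℝ} (h0 : 0 ≤ r) (h1 : r < 1) (a n : ℕ) :
    ∑ b ∈ Finset.range n, r ^ ((a - b) + (b - a)) ≤ 2 * (1 - r)⁻¹ := by
  have hs := summable_geometric_of_lt_one h0 h1
  have hle (s : Finset ℕ) : ∑ i ∈ s, r ^ i ≤ (1 - r)⁻¹ := by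
    rw [← tsum_geometric_of_lt_one h0 h1]
    exact hs.sum_le_tsum s fun i _ => pow_nonneg h0 i
  have himg (g : ℕ → ℕ) (s : Finset ℕ) (hg : Set.InjOn g s) :
      ∑ b ∈ s, r ^ g b ≤ (1 - r)⁻¹ := by
    rw [← Finset.sum_image (f := fun i => r ^ i) hg]
    exact hle _
  rw [← Finset.sum_filter_add_sum_filter_not (Finset.range n) (fun b => b ≤ a), two_mul]
  refine add_le_add (himg _ _ ?_) (himg _ _ ?_) <;>
  · intro x hx y hy hxy
    simp only [Finset.coe_filter, Finset.mem_range, Set.mem_ofPred_eq] at hx hy hxy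
    omega

/-- Schur's test for the kernel `r ^ |a - b|`. -/
lemma sum_mul_pow_dist_le {r : ℝ} (h0 : 0 ≤ r) (h1 : r < 1) (lam : ℕ → ℝ) (n : ℕ) :
    ∑ p ∈ Finset.range n ×ˢ Finset.range n,
      lam p.1 * lam p.2 * r ^ ((p.1 - p.2) + (p.2 - p.1)) ≤
      2 * (1 - r)⁻¹ * ∑ j ∈ Finset.range n, lam j ^ 2 := by
  have hrow : ∑ a ∈ Finset.range n, ∑ b ∈ Finset.range n, lam a ^ 2 * r ^ ((a - b) + (b - a)) ≤
      2 * (1 - r)⁻¹ * ∑ j ∈ Finset.range n, lam j ^ 2 := by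
    rw [Finset.mul_sum]
    refine Finset.sum_le_sum fun a _ => ?_
    rw [← Finset.mul_sum, mul_comm]
    exact mul_le_mul_of_nonneg_right (sum_range_pow_dist_le h0 h1 a n) (sq_nonneg _)
  have hcol : ∑ a ∈ Finset.range n, ∑ b ∈ Finset.range n, lam b ^ 2 * r ^ ((a - b) + (b - a)) ≤
      2 * (1 - r)⁻¹ * ∑ j ∈ Finset.range n, lam j ^ 2 := by
    rw [Finset.sum_comm]
    simpa only [add_comm] using hrow
  have hamgm : ∑ a ∈ Finset.range n, ∑ b ∈ Finset.range n,
      lam a * lam b * r ^ ((a - b) + (b - a)) ≤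
      ∑ a ∈ Finset.range n, ∑ b ∈ Finset.range n,
        (lam a ^ 2 * r ^ ((a - b) + (b - a)) + lam b ^ 2 * r ^ ((a - b) + (b - a))) / 2 := by
    refine Finset.sum_le_sum fun a _ => Finset.sum_le_sum fun b _ => ?_
    nlinarith [mul_nonneg (sq_nonneg (lam a - lam b)) (pow_nonneg h0 ((a - b) + (b - a)))]
  rw [Finset.sum_product]
  simp only [← Finset.sum_div, Finset.sum_add_distrib] at hamgm
  linarith

lemma two_pow_min_mul_pow {r : ℝ} (hr : 2 * r ^ 2 = 1) (a b : ℕ) :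
    (2 : ℝ) ^ min a b * (r ^ a * r ^ b) = r ^ ((a - b) + (b - a)) := by
  wlog h : a ≤ b generalizing a b
  · rw [min_comm, mul_comm (r ^ a), add_comm]
    exact this b a (le_of_not_ge h)
  obtain ⟨d, rfl⟩ := Nat.exists_eq_add_of_le h
  have hd : (a - (a + d)) + (a + d - a) = d := by omega
  rw [min_eq_left h, hd, pow_add, ← mul_assoc (r ^ a), ← mul_assoc, ← mul_pow, ← mul_pow]
  rw [show 2 * (r * r) = 1 by rw [← hr]; ring, one_pow, one_mul]

lemma fWt_eq {S : ℕ → Finset Pt} {lam : ℕ → ℝ} {m : ℕ}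
    (hS : ∀ i ≤ m, ∀ j ≤ m, i ≠ j → Disjoint (S i) (S j)) {j : ℕ} (hj : j ≤ m) {ξ : Pt}
    (hξ : ξ ∈ S j) : fWt S lam m ξ = lam j * ((2 : ℝ) ^ (-(1 : ℝ) / 2)) ^ j := by
  rw [fWt, Finset.sum_eq_single j, if_pos hξ, ← Real.rpow_natCast, ← Real.rpow_mul (by norm_num)]
  · ring_nf
  · intro i hi hij
    exact if_neg (Finset.disjoint_right.1
      (hS i (Nat.lt_succ_iff.1 (Finset.mem_range.1 hi)) j hj hij) hξ)
  · intro h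
    exact absurd (Finset.mem_range.2 (Nat.lt_succ_of_le hj)) h

/-- Rectangles all of whose vertices have type 3 are sparse with respect to the level sets
containing their vertices. -/
lemma exists_isSparseRect {S : ℕ → Finset Pt} {C m : ℕ} {Q : Quad}
    (hQ : Q ∈ QZeroAB S C m 3 3) :
    ∃ j : Fin 4 → ℕ, (∀ k, j k ≤ m) ∧ IsSparseRect (fun k => S (j k)) Q := by
  obtain ⟨⟨hp, hd⟩, hinj, h0, h1, h2, h3⟩ := hQ
  have hV : ∀ k : Fin 4, VertexType S C m 3 (Q k) (Q (k + 1)) (Q (k + 3)) := by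
    intro k
    fin_cases k
    exacts [h0, h1, h2, h3]
  choose j hjm hmem hcr using hV
  have hp1 : (Q 0).1 + (Q 2).1 = (Q 1).1 + (Q 3).1 := congrArg Prod.fst hp
  have hp2 : (Q 0).2 + (Q 2).2 = (Q 1).2 + (Q 3).2 := congrArg Prod.snd hp
  unfold dotQ at hd
  have e0 : (Q 0).1 = (Q 1).1 + (Q 3).1 - (Q 2).1 := by linarith
  have e0' : (Q 0).2 = (Q 1).2 + (Q 3).2 - (Q 2).2 := by linarith
  rw [e0, e0'] at hd
  refine ⟨j, hjm, hmem, ?_, ?_, ?_, ?_⟩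
  · intro k h
    have := hinj h
    revert this
    fin_cases k <;> decide
  · intro k
    unfold IsPara at hp
    fin_cases k
    · exact hp
    · exact hp.symm.trans (add_comm _ _) |>.trans rfl
    · exact (add_comm _ _).trans (hp.trans (add_comm _ _))
    · exact (add_comm _ _).trans hp.symm
  · intro k
    fin_cases k
    · change ((Q 0).1 - (Q 1).1) * ((Q 0).1 - (Q 3).1) +
        ((Q 0).2 - (Q 1).2) * ((Q 0).2 - (Q 3).2) = 0
      rw [e0, e0']
      linear_combination hd
    · change ((Q 1).1 - (Q 2).1) * ((Q 1).1 - (Q 0).1) +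
        ((Q 1).2 - (Q 2).2) * ((Q 1).2 - (Q 0).2) = 0
      rw [e0, e0']
      linear_combination -hd
    · change ((Q 2).1 - (Q 3).1) * ((Q 2).1 - (Q 1).1) +
        ((Q 2).2 - (Q 3).2) * ((Q 2).2 - (Q 1).2) = 0
      linear_combination hd
    · change ((Q 3).1 - (Q 0).1) * ((Q 3).1 - (Q 2).1) +
        ((Q 3).2 - (Q 0).2) * ((Q 3).2 - (Q 2).2) = 0
      rw [e0, e0']
      linear_combination -hd
  · intro k
    have h : crossMax S (j k) (Q k) (Q (k + 1)) (Q (k + 3)) = 1 := by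
      rcases hcr k with h | h | h
      · omega
      · omega
      · exact h.2
    exact (le_max_left _ _).trans h.le

/-- **Case III of Lemma 3.3.** `Σ_{Q ∈ 𝒬⁰_{3,3}} f(Q) ≲ ‖λ‖_{ℓ²}⁴`. -/
theorem sum_QZeroAB_33_bound (C : ℕ) :
    ∃ c : ℝ, 0 < c ∧
      ∀ (m : ℕ) (S : ℕ → Finset Pt) (lam : ℕ → ℝ),
        1 ≤ m →
        (∀ i ≤ m, ∀ j ≤ m, i ≠ j → Disjoint (S i) (S j)) →
        (∀ j ≤ m, (S j).card ≤ 2 ^ j) →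
        (∀ j ≤ m, 0 ≤ lam j) →
        (∀ j ≤ m, ∀ ξ ∈ S j, ∀ ℓ₁ ℓ₂ : Set (ℝ × ℝ), IsLine ℓ₁ → IsLine ℓ₂ →
          emb ξ ∈ ℓ₁ → emb ξ ∈ ℓ₂ →
          (2 : ℝ) ^ ((j : ℝ) / 2 + (C : ℝ)) ≤ (lineCount ℓ₁ (S j) : ℝ) →
          (2 : ℝ) ^ ((j : ℝ) / 2 + (C : ℝ)) ≤ (lineCount ℓ₂ (S j) : ℝ) → ℓ₁ = ℓ₂) →
        ∑' Q : Quad, Set.indicator (QZeroAB S C m 3 3) (fQ (fWt S lam m)) Q ≤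
          c * (∑ j ∈ Finset.range (m + 1), lam j ^ 2) ^ 2 := by
  classical
  set r : ℝ := (2 : ℝ) ^ (-(1 : ℝ) / 2) with hr
  have hr0 : 0 < r := by positivity
  have hr1 : r < 1 := Real.rpow_lt_one_of_one_lt_of_neg (by norm_num) (by norm_num)
  have hr2 : 2 * r ^ 2 = 1 := by
    rw [hr, ← Real.rpow_natCast, ← Real.rpow_mul (by norm_num)]
    norm_num [Real.rpow_neg_one]
  have hM : 0 < 2 * (1 - r)⁻¹ := mul_pos two_pos (inv_pos.2 (sub_pos.2 hr1))
  refine ⟨(2 * (1 - r)⁻¹) ^ 2, pow_pos hM 2, fun m S lam _ hdis hcard hlam _ => ?_⟩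
  choose! J hJm hJ using fun Q (hQ : Q ∈ QZeroAB S C m 3 3) => exists_isSparseRect hQ
  let U : Finset Pt := (Finset.range (m + 1)).biUnion S
  let A : Finset Quad :=
    (Fintype.piFinset fun _ : Fin 4 => U).filter fun Q => Q ∈ QZeroAB S C m 3 3
  have hA (Q : Quad) : Q ∈ A ↔ Q ∈ QZeroAB S C m 3 3 := by
    simp only [A, Finset.mem_filter, Fintype.mem_piFinset, and_iff_right_iff_imp]
    intro hQ k
    exact Finset.mem_biUnion.2
      ⟨J Q k, Finset.mem_range.2 (Nat.lt_succ_of_le (hJm Q hQ k)), (hJ Q hQ).mem k⟩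
  have hsum : ∑' Q : Quad, Set.indicator (QZeroAB S C m 3 3) (fQ (fWt S lam m)) Q =
      ∑ Q ∈ A, fQ (fWt S lam m) Q := by
    rw [tsum_eq_sum (s := A) fun Q hQ => Set.indicator_of_notMem (fun h => hQ ((hA Q).2 h)) _]
    exact Finset.sum_congr rfl fun Q hQ => Set.indicator_of_mem ((hA Q).1 hQ) _
  let R := Finset.range (m + 1) ×ˢ Finset.range (m + 1)
  let idx : Quad → (ℕ × ℕ) × (ℕ × ℕ) := fun Q => ((J Q 0, J Q 2), (J Q 1, J Q 3))
  let g : ℕ × ℕ → ℝ := fun p => lam p.1 * lam p.2 * r ^ ((p.1 - p.2) + (p.2 - p.1))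
  have hmaps : ∀ Q ∈ A, idx Q ∈ R ×ˢ R := by
    intro Q hQ
    simp only [R, idx, Finset.mem_product, Finset.mem_range, Nat.lt_succ_iff]
    have h := hJm Q ((hA Q).1 hQ)
    exact ⟨⟨h 0, h 2⟩, h 1, h 3⟩
  have hfiber : ∀ p ∈ R ×ˢ R,
      ∑ Q ∈ A.filter (fun Q => idx Q = p), fQ (fWt S lam m) Q ≤ g p.1 * g p.2 := by
    rintro ⟨⟨a, c⟩, b, d⟩ hp
    simp only [R, Finset.mem_product, Finset.mem_range, Nat.lt_succ_iff] at hp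
    obtain ⟨⟨ha, hc⟩, hb, hd⟩ := hp
    have hJeq : ∀ Q ∈ A.filter (fun Q => idx Q = ((a, c), b, d)), J Q = ![a, b, c, d] := by
      intro Q hQ
      have h := (Finset.mem_filter.1 hQ).2
      simp only [idx, Prod.mk.injEq] at h
      funext k
      fin_cases k
      exacts [h.1.1, h.2.1, h.1.2, h.2.2]
    have hsp : ∀ Q ∈ A.filter (fun Q => idx Q = ((a, c), b, d)),
        IsSparseRect (fun k => S (![a, b, c, d] k)) Q := by
      intro Q hQ
      have h := hJ Q ((hA Q).1 (Finset.mem_filter.1 hQ).1)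
      rwa [hJeq Q hQ] at h
    have hN := card_le_two_pow_of_isSparseRect (S := S) (j := ![a, b, c, d])
      (by intro k; fin_cases k; exacts [hcard a ha, hcard b hb, hcard c hc, hcard d hd]) hsp
    have hval : ∀ Q ∈ A.filter (fun Q => idx Q = ((a, c), b, d)), fQ (fWt S lam m) Q =
        lam a * r ^ a * (lam b * r ^ b) * (lam c * r ^ c) * (lam d * r ^ d) := by
      intro Q hQ
      have h := (hsp Q hQ).mem
      rw [fQ, Fin.prod_univ_four, fWt_eq hdis ha (h 0), fWt_eq hdis hb (h 1),
        fWt_eq hdis hc (h 2), fWt_eq hdis hd (h 3)]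
    have hN' : ((A.filter (fun Q => idx Q = ((a, c), b, d))).card : ℝ) ≤
        2 ^ min a c * 2 ^ min b d := by exact_mod_cast hN
    rw [Finset.sum_congr rfl hval, Finset.sum_const, nsmul_eq_mul]
    have la := hlam a ha
    have lb := hlam b hb
    have lc := hlam c hc
    have ld := hlam d hd
    refine (mul_le_mul_of_nonneg_right hN' (by positivity)).trans_eq ?_
    simp only [g, ← two_pow_min_mul_pow hr2]
    ring
  have hg0 : 0 ≤ ∑ p ∈ R, g p := by
    refine Finset.sum_nonneg fun p hp => ?_
    simp only [R, Finset.mem_product, Finset.mem_range, Nat.lt_succ_iff] at hp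
    have h1 := hlam _ hp.1
    have h2 := hlam _ hp.2
    positivity
  rw [hsum, ← Finset.sum_fiberwise_of_maps_to hmaps, ← mul_pow]
  refine (Finset.sum_le_sum hfiber).trans ?_
  rw [Finset.sum_product, ← Finset.sum_mul_sum, ← sq]
  exact pow_le_pow_left₀ hg0 (sum_mul_pow_dist_le hr0.le hr1 lam (m + 1)) 2
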